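/- Let T be a pairwise nonnegative subset of R = 𝒱″ ∪ 𝒧″ ∪ 𝒬″, and let Tors_T denote the torsion subgroup of the quotient group V/⟨T⟩, where ⟨T⟩ is the subgroup of V generated by T. Then Tors_T is either trivial, or isomorphic to ℤ/2ℤ, or isomorphic to ℤ/3ℤ. -/

import Mathlib

/-- `V = ℤ⁷`, with coordinate 0 corresponding to `L` and coordinates 1,…,6 to `E₁,…,E₆`. -/
abbrev V : Type := Fin 7 → ℤ

/-- The intersection form: `⟨x,y⟩ = x₀y₀ − Σᵢ xᵢyᵢ`. -/
def form (x y : V) : ℤ := x 0 * y 0 - ∑ i : Fin 6, x i.succ * y i.succ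

/-- The class `L` of a line. -/
def Lv : V := fun j => if j = 0 then 1 else 0

/-- The exceptional classes `E₁,…,E₆` (indexed by `Fin 6`). -/
def Ev (i : Fin 6) : V := fun j => if j = i.succ then 1 else 0

/-- The canonical class `K = −3L + E₁ + ⋯ + E₆`. -/
def Kv : V := -(3 : ℤ) • Lv + ∑ i : Fin 6, Ev i

/-- `𝒱″ = {Eᵢ − Eⱼ : 1 ≤ i < j ≤ 6}`. -/
def Vpp : Set V := {v | ∃ i j : Fin 6, i < j ∧ v = Ev i - Ev j}

/-- `𝒧″ = {L − Eᵢ − Eⱼ − Eₖ : 1 ≤ i < j < k ≤ 6}`. -/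
def Lpp : Set V := {v | ∃ i j k : Fin 6, i < j ∧ j < k ∧ v = Lv - Ev i - Ev j - Ev k}

/-- `𝒬″ = {2L − E₁ − ⋯ − E₆}`. -/
def Qpp : Set V := {v | v = (2 : ℤ) • Lv - ∑ i : Fin 6, Ev i}

/-- `R = 𝒱″ ∪ 𝒧″ ∪ 𝒬″`. -/
def Rset : Set V := Vpp ∪ Lpp ∪ Qpp

/-- A subset `T` is pairwise nonnegative if `⟨C,D⟩ ≥ 0` for all distinct `C,D ∈ T`. -/
def PairwiseNonneg (T : Set V) : Prop := ∀ C ∈ T, ∀ D ∈ T, C ≠ D → 0 ≤ form C D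

/-- Coordinates of the 36 elements of `Rset`. -/
def rootCodes : List (List ℤ) :=
  [[0,1,-1,0,0,0,0], [0,1,0,-1,0,0,0], [0,1,0,0,-1,0,0], [0,1,0,0,0,-1,0],
   [0,1,0,0,0,0,-1], [0,0,1,-1,0,0,0], [0,0,1,0,-1,0,0], [0,0,1,0,0,-1,0],
   [0,0,1,0,0,0,-1], [0,0,0,1,-1,0,0], [0,0,0,1,0,-1,0], [0,0,0,1,0,0,-1],
   [0,0,0,0,1,-1,0], [0,0,0,0,1,0,-1], [0,0,0,0,0,1,-1], [1,-1,-1,-1,0,0,0],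
   [1,-1,-1,0,-1,0,0], [1,-1,-1,0,0,-1,0], [1,-1,-1,0,0,0,-1], [1,-1,0,-1,-1,0,0],
   [1,-1,0,-1,0,-1,0], [1,-1,0,-1,0,0,-1], [1,-1,0,0,-1,-1,0], [1,-1,0,0,-1,0,-1],
   [1,-1,0,0,0,-1,-1], [1,0,-1,-1,-1,0,0], [1,0,-1,-1,0,-1,0], [1,0,-1,-1,0,0,-1],
   [1,0,-1,0,-1,-1,0], [1,0,-1,0,-1,0,-1], [1,0,-1,0,0,-1,-1], [1,0,0,-1,-1,-1,0],
   [1,0,0,-1,-1,0,-1], [1,0,0,-1,0,-1,-1], [1,0,0,0,-1,-1,-1], [2,-1,-1,-1,-1,-1,-1]]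

/-- The vector with the given list of coordinates. -/
def codeVec (c : List ℤ) : V := fun i => c.getD i.val 0

/-- The intersection form on coordinate lists. -/
def codeForm : List ℤ → List ℤ → ℤ
  | [a0, a1, a2, a3, a4, a5, a6], [b0, b1, b2, b3, b4, b5, b6] =>
    a0 * b0 - (a1 * b1 + a2 * b2 + a3 * b3 + a4 * b4 + a5 * b5 + a6 * b6)
  | _, _ => 0

/-- There is no chain of `n` further pairwise orthogonal elements in the list. -/
def noOrth : ℕ → List (List ℤ) → Bool
  | 0, _ => false
  | n + 1, l => l.all fun a => noOrth n (l.filter fun b => decide (codeForm a b = 0))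

set_option maxRecDepth 100000 in
theorem noOrth_five : noOrth 5 rootCodes = true := by decide +kernel

theorem codes_length : ∀ c ∈ rootCodes, c.length = 7 := by decide +kernel

theorem mem_codes {v : V} (hv : v ∈ Rset) : ∃ c ∈ rootCodes, v = codeVec c := by
  rcases hv with (⟨i, j, h, rfl⟩ | ⟨i, j, k, h, h', rfl⟩) | rfl
  · revert i j; decide +kernel
  · revert i j k; decide +kernel
  · decide +kernel

theorem form_codeVec {c d : List ℤ} (hc : c.length = 7) (hd : d.length = 7) :
    form (codeVec c) (codeVec d) = codeForm c d := by
  match c, d, hc, hd with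
  | [a0, a1, a2, a3, a4, a5, a6], [b0, b1, b2, b3, b4, b5, b6], _, _ =>
    simp [form, codeVec, codeForm, Fin.sum_univ_succ]
    ring

theorem noOrth_spec (n : ℕ) (l : List (List ℤ)) (h : noOrth n l = true)
    (f : Fin n → List ℤ) (hf : ∀ i, f i ∈ l) : ∃ i j, i < j ∧ codeForm (f i) (f j) ≠ 0 := by
  induction n generalizing l with
  | zero => simp [noOrth] at h
  | succ n ih =>
    by_contra! hcon
    simp only [noOrth, List.all_eq_true] at h
    obtain ⟨i, j, hij, hne⟩ := ih _ (h (f 0) (hf 0)) (fun i => f i.succ) (fun i => by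
      simp only [List.mem_filter, decide_eq_true_eq]
      exact ⟨hf _, hcon 0 i.succ (Fin.succ_pos i)⟩)
    exact hne (hcon _ _ (Fin.succ_lt_succ_iff.mpr hij))

theorem exists_edge {f : Fin 5 → V} (hf : ∀ i, f i ∈ Rset) :
    ∃ i j, i < j ∧ form (f i) (f j) ≠ 0 := by
  choose g hg hfg using fun i => mem_codes (hf i)
  obtain ⟨i, j, hij, h⟩ := noOrth_spec 5 _ noOrth_five g hg
  refine ⟨i, j, hij, ?_⟩
  rwa [hfg, hfg, form_codeVec (codes_length _ (hg i)) (codes_length _ (hg j))]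

theorem exists_edge_finset {b : Fin 7 → V} (s : Finset (Fin 7)) (hs : 5 ≤ s.card)
    (h : ∀ i ∈ s, b i ∈ Rset) : ∃ i ∈ s, ∃ j ∈ s, i ≠ j ∧ form (b i) (b j) ≠ 0 := by
  obtain ⟨t, hts, ht⟩ := Finset.exists_subset_card_eq hs
  obtain ⟨i, j, hij, hne⟩ := exists_edge (f := fun i => b (t.orderEmbOfFin ht i))
    (fun i => h _ (hts (Finset.orderEmbOfFin_mem t ht i)))
  exact ⟨_, hts (Finset.orderEmbOfFin_mem t ht i), _, hts (Finset.orderEmbOfFin_mem t ht j),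
    fun e => hij.ne ((t.orderEmbOfFin ht).injective e), hne⟩

theorem form_self {v : V} (hv : v ∈ Rset) : form v v = -2 := by
  obtain ⟨c, hc, rfl⟩ := mem_codes hv
  rw [form_codeVec (codes_length _ hc) (codes_length _ hc)]
  clear hv; revert c; decide +kernel

theorem degK {v : V} (hv : v ∈ Rset) :
    3 * v 0 + v 1 + v 2 + v 3 + v 4 + v 5 + v 6 = 0 := by
  obtain ⟨c, hc, rfl⟩ := mem_codes hv
  clear hv; revert c; decide +kernel

theorem hadamard (M : Matrix (Fin 7) (Fin 7) ℝ) : M.det ^ 2 ≤ ∏ i, ∑ j, M i j ^ 2 := by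
  let bs := EuclideanSpace.basisFun (Fin 7) ℝ
  have : Fact (Module.finrank ℝ (EuclideanSpace ℝ (Fin 7)) = 7) := ⟨by simp⟩
  let v : Fin 7 → EuclideanSpace ℝ (Fin 7) := fun i => WithLp.toLp 2 (M i)
  have h := bs.toBasis.orientation.abs_volumeForm_apply_le v
  rw [bs.toBasis.orientation.volumeForm_robust bs rfl] at h
  have hd : bs.toBasis.det v = M.det := by
    rw [Module.Basis.det_apply, ← Matrix.det_transpose]
    congr 1
  rw [hd] at h
  have h2 := pow_le_pow_left₀ (abs_nonneg _) h 2
  rw [sq_abs, ← Finset.prod_pow] at h2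
  simpa [EuclideanSpace.norm_sq_eq, v] using h2

/-- An auxiliary positive definite form, equal to minus the intersection form on `K^⊥`. -/
def Qm : Matrix (Fin 7) (Fin 7) ℝ :=
  !![44, 15, 15, 15, 15, 15, 15;
     15, 6, 5, 5, 5, 5, 5;
     15, 5, 6, 5, 5, 5, 5;
     15, 5, 5, 6, 5, 5, 5;
     15, 5, 5, 5, 6, 5, 5;
     15, 5, 5, 5, 5, 6, 5;
     15, 5, 5, 5, 5, 5, 6]

/-- The explicit bilinear form with matrix `Qm`. -/
def qf (x y : Fin 7 → ℝ) : ℝ :=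
  -(x 0 * y 0) + x 1 * y 1 + x 2 * y 2 + x 3 * y 3 + x 4 * y 4 + x 5 * y 5 + x 6 * y 6
    + 5 * (3 * x 0 + x 1 + x 2 + x 3 + x 4 + x 5 + x 6) *
      (3 * y 0 + y 1 + y 2 + y 3 + y 4 + y 5 + y 6)

theorem qf_eq (x y : Fin 7 → ℝ) : x ⬝ᵥ Matrix.mulVec Qm y = qf x y := by
  simp [Qm, qf, dotProduct, Matrix.mulVec, Fin.sum_univ_succ]
  ring

theorem qf_nonneg (x : Fin 7 → ℝ) : 0 ≤ qf x x := by
  unfold qf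
  generalize x 0 = a
  generalize x 1 = p
  generalize x 2 = q
  generalize x 3 = r
  generalize x 4 = s
  generalize x 5 = t
  generalize x 6 = u
  have h : (p + q + r + s + t + u) ^ 2 ≤ 6 * (p^2+q^2+r^2+s^2+t^2+u^2) := by
    nlinarith [sq_nonneg (p-q), sq_nonneg (p-r), sq_nonneg (p-s), sq_nonneg (p-t), sq_nonneg (p-u),
      sq_nonneg (q-r), sq_nonneg (q-s), sq_nonneg (q-t), sq_nonneg (q-u), sq_nonneg (r-s),
      sq_nonneg (r-t), sq_nonneg (r-u), sq_nonneg (s-t), sq_nonneg (s-u), sq_nonneg (t-u)]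
  nlinarith [sq_nonneg (44 * a + 15 * (p + q + r + s + t + u)), sq_nonneg (p + q + r + s + t + u)]

theorem Qm_det : Qm.det = 14 := by
  unfold Qm
  eval_det

theorem Qm_psd : Qm.PosSemidef := by
  refine Matrix.PosSemidef.of_dotProduct_mulVec_nonneg ?_ ?_
  · ext i j
    fin_cases i <;> fin_cases j <;> simp [Qm]
  · intro x
    simpa [qf_eq] using qf_nonneg x

open scoped MatrixOrder in
theorem hadamardQ (M : Matrix (Fin 7) (Fin 7) ℝ) : 14 * M.det ^ 2 ≤ ∏ i, qf (M i) (M i) := by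
  obtain ⟨W, hW⟩ := CStarAlgebra.nonneg_iff_eq_star_mul_self.mp Qm_psd.nonneg
  rw [Matrix.star_eq_conjTranspose] at hW
  rw [Matrix.conjTranspose_eq_transpose_of_trivial] at hW
  have h := hadamard (M * W.transpose)
  have h1 : (M * W.transpose).det ^ 2 = 14 * M.det ^ 2 := by
    rw [← Qm_det, hW, Matrix.det_mul, Matrix.det_mul, Matrix.det_transpose]; ring
  rw [h1] at h
  refine h.trans_eq (Finset.prod_congr rfl fun i _ => ?_)
  rw [← qf_eq, hW, ← Matrix.mulVec_mulVec, Matrix.dotProduct_mulVec, Matrix.vecMul_transpose]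
  simp [dotProduct, Matrix.mulVec, Matrix.mul_apply, sq, mul_comm]

/-- The real matrix underlying a family of lattice vectors. -/
def realVec (v : V) : Fin 7 → ℝ := fun j => (v j : ℝ)

theorem qf_root {v w : V} (hv : v ∈ Rset) : qf (realVec v) (realVec w) = -(form v w : ℝ) := by
  have h : (3 * v 0 + v 1 + v 2 + v 3 + v 4 + v 5 + v 6 : ℝ) = 0 := by exact_mod_cast degK hv
  simp only [qf, realVec, h, form, Fin.sum_univ_succ]
  simp
  ring

theorem qf_root_self {v : V} (hv : v ∈ Rset) : qf (realVec v) (realVec v) = 2 := by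
  rw [qf_root hv, form_self hv]; norm_num

theorem qf_E : qf (realVec (Ev 5)) (realVec (Ev 5)) = 6 := by
  simp [qf, realVec, Ev, Fin.ext_iff]; norm_num

theorem qf_reduce {v w : V} (hv : v ∈ Rset) (hw : w ∈ Rset) (h : form v w ≠ 0) :
    qf (realVec v + ((form v w : ℝ) / 2) • realVec w)
      (realVec v + ((form v w : ℝ) / 2) • realVec w) ≤ 3 / 2 := by
  have expand : ∀ (x y : Fin 7 → ℝ) (t : ℝ), qf (x + t • y) (x + t • y) =
      qf x x + 2 * t * qf x y + t ^ 2 * qf y y := by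
    intro x y t
    simp only [qf, Pi.add_apply, Pi.smul_apply, smul_eq_mul]
    ring
  rw [expand, qf_root_self hv, qf_root_self hw, qf_root hv]
  have h1 : (1 : ℝ) ≤ (form v w : ℝ) ^ 2 := by
    exact_mod_cast Int.one_le_abs h |>.trans (by rw [← sq_abs]; nlinarith [Int.one_le_abs h])
  nlinarith

theorem det_bound (b : Fin 7 → V) (i0 : Fin 7) (hb : ∀ i, i ≠ i0 → b i ∈ Rset)
    (hb0 : b i0 ∈ Rset ∨ b i0 = Ev 5) : (Matrix.of b).det.natAbs ≤ 3 := by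
  obtain ⟨a, ha, c, hc, hac, hf1⟩ := exists_edge_finset (b := b) (Finset.univ.erase i0)
    (by simp) (fun i hi => hb i (Finset.ne_of_mem_erase hi))
  obtain ⟨d, hd, e, he, hde, hf2⟩ := exists_edge_finset (b := b) ((Finset.univ.erase i0).erase a)
    (by rw [Finset.card_erase_of_mem ha]; simp)
    (fun i hi => hb i (Finset.ne_of_mem_erase (Finset.mem_of_mem_erase hi)))
  simp only [Finset.mem_erase, Finset.mem_univ, and_true] at ha hc hd he
  let M : Matrix (Fin 7) (Fin 7) ℝ := Matrix.of fun i => realVec (b i)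
  let M1 := M.updateRow a (M a + ((form (b a) (b c) : ℝ) / 2) • M c)
  let M2 := M1.updateRow d (M1 d + ((form (b d) (b e) : ℝ) / 2) • M1 e)
  have hdet : M2.det = M.det := by
    rw [Matrix.det_updateRow_add_smul_self _ hde, Matrix.det_updateRow_add_smul_self _ hac]
  have hM1 : ∀ i, i ≠ a → M1 i = realVec (b i) := fun i hi => by
    simp only [M1, Matrix.updateRow_ne hi]; rfl
  have hM2a : qf (M2 a) (M2 a) ≤ 3 / 2 := by
    have : M2 a = realVec (b a) + ((form (b a) (b c) : ℝ) / 2) • realVec (b c) := by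
      simp only [M2, M1, Matrix.updateRow_ne hd.1.symm, Matrix.updateRow_self]; rfl
    rw [this]
    exact qf_reduce (hb _ ha) (hb _ hc) hf1
  have hM2d : qf (M2 d) (M2 d) ≤ 3 / 2 := by
    have : M2 d = realVec (b d) + ((form (b d) (b e) : ℝ) / 2) • realVec (b e) := by
      simp only [M2, Matrix.updateRow_self, hM1 d hd.1, hM1 e he.1]
    rw [this]
    exact qf_reduce (hb _ hd.2) (hb _ he.2) hf2
  have hM2 : ∀ i, i ≠ a → i ≠ d → M2 i = realVec (b i) := fun i hi hi' => by
    simp only [M2, Matrix.updateRow_ne hi', hM1 i hi]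
  let g : Fin 7 → ℝ := fun i => if i = a then 3 / 2 else if i = d then 3 / 2 else
    if i = i0 then 6 else 2
  have hle : ∀ i, qf (M2 i) (M2 i) ≤ g i := by
    intro i
    by_cases h1 : i = a
    · subst h1; simpa [g] using hM2a
    by_cases h2 : i = d
    · subst h2; simpa [g, h1] using hM2d
    simp only [g, h1, h2, if_false, hM2 i h1 h2]
    by_cases h3 : i = i0
    · subst h3
      simp only [if_true]
      rcases hb0 with h | h
      · rw [qf_root_self h]; norm_num
      · rw [h, qf_E]
    · simp only [h3, if_false]
      rw [qf_root_self (hb i h3)]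
  have hprod : ∏ i, g i = 216 := by
    have h1 : ∏ i, g i = g a * (g d * (g i0 * ∏ i ∈ ((Finset.univ.erase a).erase d).erase i0, g i)) := by
      rw [Finset.mul_prod_erase, Finset.mul_prod_erase, Finset.mul_prod_erase] <;>
        simp [hd.1, Ne.symm ha, Ne.symm hd.2]
    have h2 : ∏ i ∈ ((Finset.univ.erase a).erase d).erase i0, g i = 2 ^ 4 := by
      rw [Finset.prod_congr rfl (g := fun _ => (2 : ℝ)), Finset.prod_const]
      · rw [Finset.card_erase_of_mem, Finset.card_erase_of_mem] <;>
          simp [hd.1, Ne.symm ha, Ne.symm hd.2]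
      · intro i hi
        simp only [Finset.mem_erase, Finset.mem_univ, and_true] at hi
        simp [g, hi.1, hi.2.1, hi.2.2]
    rw [h1, h2]
    simp [g, hd.1, Ne.symm ha, Ne.symm hd.2]
    norm_num
  have hfin := (hadamardQ M2).trans
    (Finset.prod_le_prod (fun i _ => qf_nonneg (M2 i)) (fun i _ => hle i))
  rw [hprod, hdet] at hfin
  have hcast : M.det = ((Matrix.of b).det : ℝ) := by
    rw [Int.cast_det]; rfl
  rw [hcast] at hfin
  have hint : 14 * (Matrix.of b).det ^ 2 ≤ 216 := by exact_mod_cast hfin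
  generalize (Matrix.of b).det = D at hint
  have h1 : D ≤ 3 := by nlinarith
  have h2 : -3 ≤ D := by nlinarith
  omega

/-- The embedding of the lattice into `ℚ⁷`. -/
def ratHom : V →ₗ[ℤ] (Fin 7 → ℚ) where
  toFun v := fun j => (v j : ℚ)
  map_add' v w := by ext; simp
  map_smul' n v := by ext; simp

theorem card_le_three (T : Set V) (hTR : T ⊆ Rset) :
    Finite (AddCommGroup.torsion (V ⧸ AddSubgroup.closure T)) ∧
    Nat.card (AddCommGroup.torsion (V ⧸ AddSubgroup.closure T)) ≤ 3 := by
  obtain ⟨B0, hB0T, hB0span, hB0⟩ := exists_linearIndependent ℚ (ratHom '' T)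
  have hsub : B0 ⊆ ratHom '' insert (Ev 5) Rset :=
    hB0T.trans (Set.image_mono (hTR.trans (Set.subset_insert _ _)))
  have hB0' : LinearIndepOn ℚ id B0 := hB0
  let B := hB0'.extend hsub
  have hB : LinearIndepOn ℚ id B := hB0'.linearIndepOn_extend hsub
  have hBB : B ⊆ ratHom '' insert (Ev 5) Rset := hB0'.extend_subset hsub
  have hB0B : B0 ⊆ B := hB0'.subset_extend hsub
  have hR : ∀ v ∈ Rset, ratHom v ∈ Submodule.span ℚ B := fun v hv =>
    hB0'.subset_span_extend hsub ⟨v, Or.inr hv, rfl⟩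
  have hE5 : ratHom (Ev 5) ∈ Submodule.span ℚ B :=
    hB0'.subset_span_extend hsub ⟨_, Or.inl rfl, rfl⟩
  have hEE : ∀ i : Fin 6, ratHom (Ev i) ∈ Submodule.span ℚ B := by
    intro i
    by_cases hi : i = 5
    · rw [hi]; exact hE5
    · have h := hR (Ev i - Ev 5) (Or.inl (Or.inl ⟨i, 5, by omega, rfl⟩))
      rw [map_sub] at h
      simpa using Submodule.add_mem _ h hE5
  have hL : ratHom Lv ∈ Submodule.span ℚ B := by
    have h := hR (Lv - Ev 0 - Ev 1 - Ev 2) (Or.inl (Or.inr ⟨0, 1, 2, by decide, by decide, rfl⟩))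
    rw [map_sub, map_sub, map_sub] at h
    simpa using Submodule.add_mem _ (Submodule.add_mem _ (Submodule.add_mem _ h (hEE 2)) (hEE 1))
      (hEE 0)
  have htop : ⊤ ≤ Submodule.span ℚ (Set.range (Subtype.val : B → Fin 7 → ℚ)) := by
    rw [Subtype.range_coe, ← (Pi.basisFun ℚ (Fin 7)).span_eq, Submodule.span_le]
    rintro _ ⟨j, rfl⟩
    refine Fin.cases ?_ (fun i => ?_) j
    · have h0 : Pi.basisFun ℚ (Fin 7) 0 = ratHom Lv := by
        ext k; simp [ratHom, Lv, Pi.single_apply]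
      rw [h0]; exact hL
    · have h0 : Pi.basisFun ℚ (Fin 7) i.succ = ratHom (Ev i) := by
        ext k; simp [ratHom, Ev, Pi.single_apply]
      rw [h0]; exact hEE i
  let bs : Module.Basis B ℚ (Fin 7 → ℚ) := Module.Basis.mk hB htop
  let e : B ≃ Fin 7 := bs.indexEquiv (Pi.basisFun ℚ (Fin 7))
  let c := bs.reindex e
  have hc : ∀ i, c i = (e.symm i : Fin 7 → ℚ) := fun i => by simp [c, bs]
  have hex : ∀ i, ∃ v ∈ insert (Ev 5) Rset, ratHom v = c i := fun i => by
    rw [hc]; exact hBB (e.symm i).2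
  choose b hbR hbc using hex
  -- all but at most one of the vectors are roots
  obtain ⟨i0, hi0⟩ : ∃ i0, ∀ i, i ≠ i0 → b i ∈ Rset := by
    by_cases h : ∃ i0, b i0 = Ev 5
    · obtain ⟨i0, h0⟩ := h
      refine ⟨i0, fun i hi => ?_⟩
      rcases hbR i with h1 | h1
      · exact absurd (c.injective (by rw [← hbc, ← hbc, h1, h0])) hi
      · exact h1
    · push Not at h
      exact ⟨0, fun i _ => (hbR i).resolve_left (h i)⟩
  have hdet := det_bound b i0 hi0 ((hbR i0).symm)
  -- the lattice spanned by the family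
  have hbind : LinearIndependent ℤ b := by
    have h1 : LinearIndependent ℤ c := c.linearIndependent.restrict_scalars (by
      intro x y h; simpa using h)
    have h2 : LinearIndependent ℤ (ratHom ∘ b) := by
      convert h1 using 1
      funext i; exact hbc i
    exact h2.of_comp
  let N : Submodule ℤ V := Submodule.span ℤ (Set.range b)
  let bN : Module.Basis (Fin 7) ℤ N := Module.Basis.span hbind
  have hcard := Submodule.natAbs_det_basis_change (Pi.basisFun ℤ (Fin 7)) N bN
  have hbdet : (Pi.basisFun ℤ (Fin 7)).det ((↑) ∘ bN) = (Matrix.of b).det := by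
    have : ((↑) ∘ bN : Fin 7 → V) = b := by
      funext i; exact congrArg Subtype.val (Module.Basis.span_apply hbind i)
    rw [this, Module.Basis.det_apply, ← Matrix.det_transpose]
    congr 1
  rw [hbdet] at hcard
  have hdne : (Matrix.of b).det ≠ 0 := by
    have h : (Matrix.of b).det = (Pi.basisFun ℤ (Fin 7)).det ((↑) ∘ bN) := hbdet.symm
    intro h0
    have := Matrix.exists_vecMul_eq_zero_iff.mpr h0
    obtain ⟨w, hw, hw0⟩ := this
    refine hw (funext fun i => Fintype.linearIndependent_iff.mp hbind w ?_ i)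
    rw [← hw0]
    funext j
    simp [Matrix.vecMul, dotProduct]
  have hfinN : Finite (V ⧸ N) := Nat.finite_of_card_ne_zero (by
    rw [← hcard]; exact Int.natAbs_ne_zero.mpr hdne)
  -- torsion elements lie in the rational span of `B0`
  have htors : ∀ x : V, (∃ n : ℕ, 0 < n ∧ n • x ∈ AddSubgroup.closure T) →
      ratHom x ∈ Submodule.span ℚ B0 := by
    rintro x ⟨n, hn, hx⟩
    have h1 : ratHom (n • x) ∈ Submodule.span ℚ B0 := by
      rw [hB0span]
      have hle : AddSubgroup.closure T ≤
          ((Submodule.span ℚ (ratHom '' T)).toAddSubgroup).comap ratHom.toAddMonoidHom := by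
        rw [AddSubgroup.closure_le]
        intro t ht
        exact Submodule.subset_span ⟨t, ht, rfl⟩
      exact hle hx
    rw [map_nsmul, ← Nat.cast_smul_eq_nsmul ℚ] at h1
    exact (Submodule.smul_mem_iff _ (by exact_mod_cast hn.ne')).mp h1
  have hkey : ∀ x : V, x ∈ N → ratHom x ∈ Submodule.span ℚ B0 → x ∈ AddSubgroup.closure T := by
    intro x hxN hx
    obtain ⟨w, rfl⟩ := (Submodule.mem_span_range_iff_exists_fun ℤ).mp hxN
    have hB0img : B0 = c '' {i | c i ∈ B0} := by
      ext y
      constructor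
      · intro hy
        refine ⟨e ⟨y, hB0B hy⟩, ?_, ?_⟩ <;> simp [hc, hy]
      · rintro ⟨i, hi, rfl⟩; exact hi
    rw [hB0img, Module.Basis.mem_span_image] at hx
    refine AddSubgroup.sum_mem _ fun i _ => ?_
    by_cases hwi : w i = 0
    · simp [hwi]
    · have hi : c i ∈ B0 := by
        apply hx
        have : ratHom (∑ j, w j • b j) = ∑ j, (w j : ℚ) • c j := by
          rw [map_sum]
          refine Finset.sum_congr rfl fun j _ => ?_
          rw [map_smul, hbc, Int.cast_smul_eq_zsmul]
        rw [Finset.mem_coe, Finsupp.mem_support_iff, this, Module.Basis.repr_sum_self]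
        exact_mod_cast hwi
      obtain ⟨t, ht, hti⟩ := hB0T hi
      have : b i = t := by
        rw [← hbc i] at hti
        funext j
        have : (t j : ℚ) = (b i j : ℚ) := congrFun hti j
        exact_mod_cast this.symm
      rw [this]
      exact AddSubgroup.zsmul_mem _ (AddSubgroup.subset_closure ht) _
  let f : AddCommGroup.torsion (V ⧸ AddSubgroup.closure T) → V ⧸ N :=
    fun x => Submodule.Quotient.mk (Quotient.out x.1)
  have hf : Function.Injective f := by
    intro x y hxy
    have h1 := (Submodule.Quotient.eq N).mp hxy
    have hx : (QuotientAddGroup.mk (Quotient.out x.1) : V ⧸ AddSubgroup.closure T) = x.1 :=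
      Quotient.out_eq _
    have hy : (QuotientAddGroup.mk (Quotient.out y.1) : V ⧸ AddSubgroup.closure T) = y.1 :=
      Quotient.out_eq _
    have h2 : ratHom (Quotient.out x.1 - Quotient.out y.1) ∈ Submodule.span ℚ B0 := by
      apply htors
      obtain ⟨n, hn, h⟩ := isOfFinAddOrder_iff_nsmul_eq_zero.mp (x - y).2
      refine ⟨n, hn, ?_⟩
      rw [← QuotientAddGroup.eq_zero_iff]
      rw [QuotientAddGroup.mk_nsmul, QuotientAddGroup.mk_sub, hx, hy]
      exact h
    have h3 := hkey _ h1 h2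
    apply Subtype.ext
    rw [← sub_eq_zero, ← hx, ← hy, ← QuotientAddGroup.mk_sub, QuotientAddGroup.eq_zero_iff]
    exact h3
  exact ⟨Finite.of_injective f hf, (Nat.card_le_card_of_injective f hf).trans (hcard ▸ hdet)⟩

/-- for a pairwise nonnegative `T ⊆ R`, the torsion subgroup of `V/⟨T⟩`
is trivial, or isomorphic to `ℤ/2ℤ`, or isomorphic to `ℤ/3ℤ`. -/
theorem torsion_trivial_or_Z2_or_Z3 (T : Set V) (hTR : T ⊆ Rset) (hT : PairwiseNonneg T) :
    Subsingleton (AddCommGroup.torsion (V ⧸ AddSubgroup.closure T)) ∨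
    Nonempty ((AddCommGroup.torsion (V ⧸ AddSubgroup.closure T)) ≃+ ZMod 2) ∨
    Nonempty ((AddCommGroup.torsion (V ⧸ AddSubgroup.closure T)) ≃+ ZMod 3) := by
  obtain ⟨hfin, hcard⟩ := card_le_three T hTR
  have hprime : ∀ p : ℕ, p.Prime →
      Nat.card (AddCommGroup.torsion (V ⧸ AddSubgroup.closure T)) = p →
      Nonempty ((AddCommGroup.torsion (V ⧸ AddSubgroup.closure T)) ≃+ ZMod p) := by
    intro p hp h
    have := Fact.mk hp
    have hcyc : IsAddCyclic (AddCommGroup.torsion (V ⧸ AddSubgroup.closure T)) :=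
      isAddCyclic_of_prime_card h
    exact ⟨((zmodAddCyclicAddEquiv hcyc).symm).trans (ZMod.ringEquivCongr h).toAddEquiv⟩
  have hpos : 0 < Nat.card (AddCommGroup.torsion (V ⧸ AddSubgroup.closure T)) := Nat.card_pos
  have h3 : Nat.card (AddCommGroup.torsion (V ⧸ AddSubgroup.closure T)) = 1 ∨
      Nat.card (AddCommGroup.torsion (V ⧸ AddSubgroup.closure T)) = 2 ∨
      Nat.card (AddCommGroup.torsion (V ⧸ AddSubgroup.closure T)) = 3 := by omega
  rcases h3 with h | h | h
  · exact Or.inl (Nat.card_eq_one_iff_unique.mp h).1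
  · exact Or.inr (Or.inl (hprime 2 Nat.prime_two h))
  · exact Or.inr (Or.inr (hprime 3 Nat.prime_three h))
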